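/- Two R^n-immersions (f, f') and (g, g') of a co-oriented (n−1)-simplex into R^{2n-1} that are tangent on the boundary are R^n-regularly homotopic rel boundary if and only if the obstruction o(f', g') vanishes. -/

import Mathlib

open Set Function Metric

/-- The data of an `ℝⁿ`-immersion `(f, f')` of a subset `A ⊆ ℝⁿ` in `ℝ^q`: there is an
immersion `l` of a neighbourhood of `A` whose value and differential agree with
`(f, f')` on `A`. -/
def IsRnImmOnData (n q : ℕ) (A : Set (Fin n → ℝ))
    (f : (Fin n → ℝ) → (Fin q → ℝ))
    (f' : (Fin n → ℝ) → ((Fin n → ℝ) →L[ℝ] (Fin q → ℝ))) : Prop :=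
  ∃ (U : Set (Fin n → ℝ)) (l : (Fin n → ℝ) → (Fin q → ℝ)),
    IsOpen U ∧ A ⊆ U ∧ ContDiffOn ℝ (⊤ : ℕ∞) l U ∧
    (∀ x ∈ U, Injective (fderivWithin ℝ l U x)) ∧
    (∀ x ∈ A, l x = f x) ∧ (∀ x ∈ A, fderivWithin ℝ l U x = f' x)

/-- An `ℝⁿ`-immersion of `A ⊆ ℝⁿ` in `ℝ^q`. -/
structure RnImmOn (n q : ℕ) (A : Set (Fin n → ℝ)) where
  f : (Fin n → ℝ) → (Fin q → ℝ)
  f' : (Fin n → ℝ) → ((Fin n → ℝ) →L[ℝ] (Fin q → ℝ))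
  imm : IsRnImmOnData n q A f f'

/-- Restriction of an `ℝⁿ`-immersion to a smaller subset. -/
def RnImmOn.restrict {n q : ℕ} {A B : Set (Fin n → ℝ)} (h : B ⊆ A)
    (F : RnImmOn n q A) : RnImmOn n q B :=
  ⟨F.f, F.f', by
    obtain ⟨U, l, h1, h2, h3, h4, h5, h6⟩ := F.imm
    exact ⟨U, l, h1, h.trans h2, h3, h4, fun x hx => h5 x (h hx),
      fun x hx => h6 x (h hx)⟩⟩

/-- Two `ℝⁿ`-immersions are tangent on `B` if their values and differentials agree
there. -/
def TangentOn {n q : ℕ} {A : Set (Fin n → ℝ)} (F G : RnImmOn n q A)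
    (B : Set (Fin n → ℝ)) : Prop :=
  EqOn F.f G.f B ∧ EqOn F.f' G.f' B

/-- An `ℝⁿ`-regular homotopy between `F` and `G` rel `B`: a path of `ℝⁿ`-immersions of
`A` joining `F` to `G` and fixed, together with the differentials, on `B`. -/
def RnImmHomotopicRel {n q : ℕ} {A : Set (Fin n → ℝ)} (F G : RnImmOn n q A)
    (B : Set (Fin n → ℝ)) : Prop :=
  ∃ (H : (Fin n → ℝ) × ℝ → (Fin q → ℝ))
    (H' : (Fin n → ℝ) × ℝ → ((Fin n → ℝ) →L[ℝ] (Fin q → ℝ))),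
    ContinuousOn H (A ×ˢ Icc (0 : ℝ) 1) ∧ ContinuousOn H' (A ×ˢ Icc (0 : ℝ) 1) ∧
    (∀ t ∈ Icc (0 : ℝ) 1,
      IsRnImmOnData n q A (fun x => H (x, t)) (fun x => H' (x, t))) ∧
    (∀ x ∈ A, H (x, 0) = F.f x ∧ H' (x, 0) = F.f' x) ∧
    (∀ x ∈ A, H (x, 1) = G.f x ∧ H' (x, 1) = G.f' x) ∧
    (∀ t ∈ Icc (0 : ℝ) 1, ∀ x ∈ B, H (x, t) = F.f x ∧ H' (x, t) = F.f' x)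

/-- The unit sphere `S^{n-1} ⊆ ℝⁿ`. -/
def sphSet (n : ℕ) : Set (Fin n → ℝ) := {x | ∑ i, (x i) ^ 2 = 1}

/-- The upper hemisphere: a co-oriented `(n-1)`-simplex. -/
def upperHemi (n : ℕ) [NeZero n] : Set (Fin n → ℝ) := {x ∈ sphSet n | 0 ≤ x 0}

/-- Its boundary, the equator `∂Δ^{n-1}`. -/
def equatorSet (n : ℕ) [NeZero n] : Set (Fin n → ℝ) := {x ∈ sphSet n | x 0 = 0}

/-- The Stiefel manifold `V_{q,n}` of `n`-frames in `ℝ^q`, realised as the space of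
injective linear maps. -/
noncomputable def StiefelL (n q : ℕ) : Type :=
  {L : (Fin n → ℝ) →L[ℝ] (Fin q → ℝ) // Injective L}

noncomputable instance (n q : ℕ) : TopologicalSpace (StiefelL n q) :=
  instTopologicalSpaceSubtype

/-- Injective linear maps between finite-dimensional spaces have left inverses depending
continuously on the map. -/
lemma exists_continuousOn_leftInverse (E F : Type*)
    [NormedAddCommGroup E] [NormedSpace ℝ E] [FiniteDimensional ℝ E]
    [NormedAddCommGroup F] [NormedSpace ℝ F] [FiniteDimensional ℝ F] :
    ∃ Λ : (E →L[ℝ] F) → (F →L[ℝ] E), ContinuousOn Λ {L | Injective L} ∧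
      ∀ L : E →L[ℝ] F, Injective L → ∀ x, Λ L (L x) = x := by
  let a := toEuclidean (E := E)
  let b := toEuclidean (E := F)
  let M : (E →L[ℝ] F) → (EuclideanSpace ℝ (Fin (Module.finrank ℝ E)) →L[ℝ]
      EuclideanSpace ℝ (Fin (Module.finrank ℝ F))) := fun L =>
    (b : F →L[ℝ] _).comp (L.comp (a.symm : _ →L[ℝ] E))
  let P : (E →L[ℝ] F) → (EuclideanSpace ℝ (Fin (Module.finrank ℝ E)) →L[ℝ]
      EuclideanSpace ℝ (Fin (Module.finrank ℝ E))) := fun L =>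
    (ContinuousLinearMap.adjoint (M L)).comp (M L)
  have hM : Continuous M := by fun_prop
  have hMa : Continuous fun L => ContinuousLinearMap.adjoint (M L) :=
    ContinuousLinearMap.adjoint.continuous.comp hM
  have hP : Continuous P := hMa.clm_comp hM
  have hunit : ∀ L : E →L[ℝ] F, Injective L → IsUnit (P L) := by
    intro L hL
    have hMi : Injective (M L) := b.injective.comp (hL.comp a.symm.injective)
    have hPi : Injective (P L) := by
      rw [injective_iff_map_eq_zero]
      intro x hx
      have h : inner ℝ (M L x) (M L x) = (0 : ℝ) := by
        rw [← ContinuousLinearMap.adjoint_inner_right]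
        have : ContinuousLinearMap.adjoint (M L) (M L x) = 0 := hx
        rw [this, inner_zero_right]
      rw [inner_self_eq_zero] at h
      exact hMi (by rw [h, map_zero])
    rw [ContinuousLinearMap.isUnit_iff_bijective]
    exact ⟨hPi, (LinearMap.injective_iff_surjective (f := (P L).toLinearMap)).1 hPi⟩
  refine ⟨fun L => (a.symm : _ →L[ℝ] E).comp ((Ring.inverse (P L)).comp
    ((ContinuousLinearMap.adjoint (M L)).comp (b : F →L[ℝ] _))), ?_, ?_⟩
  · intro L hL
    obtain ⟨u, hu⟩ := hunit L hL
    have h1 : ContinuousAt (fun L => Ring.inverse (P L)) L := by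
      have := NormedRing.inverse_continuousAt u
      rw [hu] at this
      exact this.comp hP.continuousAt
    refine ContinuousAt.continuousWithinAt ?_
    exact continuousAt_const.clm_comp
      (h1.clm_comp (hMa.continuousAt.clm_comp continuousAt_const))
  · intro L hL x
    have h := Ring.inverse_mul_cancel _ (hunit L hL)
    have h2 := DFunLike.congr_fun h (a x)
    have h3 : M L (a x) = b (L x) := by simp [M]
    have h4 : Ring.inverse (P L) (ContinuousLinearMap.adjoint (M L) (b (L x))) = a x := by
      rw [← h3]; exact h2
    change a.symm (Ring.inverse (P L) (ContinuousLinearMap.adjoint (M L) (b (L x)))) = x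
    rw [h4, ContinuousLinearEquiv.symm_apply_apply]

/-- A family of injective linear maps over a compact set is bounded below uniformly. -/
lemma exists_forall_norm_le_mul_norm {T E F : Type*} [TopologicalSpace T]
    [NormedAddCommGroup E] [NormedSpace ℝ E] [FiniteDimensional ℝ E]
    [NormedAddCommGroup F] [NormedSpace ℝ F] [FiniteDimensional ℝ F]
    {X : Set T} (hX : IsCompact X) {M : T → E →L[ℝ] F} (hM : ContinuousOn M X)
    (hinj : ∀ p ∈ X, Injective (M p)) :
    ∃ C, 0 ≤ C ∧ ∀ p ∈ X, ∀ z, ‖z‖ ≤ C * ‖M p z‖ := by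
  obtain ⟨Λ, hΛ, hΛl⟩ := exists_continuousOn_leftInverse E F
  obtain ⟨C, hC⟩ := hX.exists_bound_of_continuousOn (hΛ.comp hM hinj)
  refine ⟨max C 0, le_max_right _ _, fun p hp z => ?_⟩
  calc ‖z‖ = ‖Λ (M p) (M p z)‖ := by rw [hΛl _ (hinj p hp)]
    _ ≤ ‖Λ (M p)‖ * ‖M p z‖ := ContinuousLinearMap.le_opNorm _ _
    _ ≤ max C 0 * ‖M p z‖ := by
      gcongr
      exact (hC p hp).trans (le_max_left _ _)

/-- Linear maps uniformly close to a compact family of injective maps are injective. -/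
lemma exists_forall_norm_sub_lt_injective {T E F : Type*} [TopologicalSpace T]
    [NormedAddCommGroup E] [NormedSpace ℝ E] [FiniteDimensional ℝ E]
    [NormedAddCommGroup F] [NormedSpace ℝ F] [FiniteDimensional ℝ F]
    {X : Set T} (hX : IsCompact X) {M : T → E →L[ℝ] F} (hM : ContinuousOn M X)
    (hinj : ∀ p ∈ X, Injective (M p)) :
    ∃ ε, 0 < ε ∧ ∀ p ∈ X, ∀ L : E →L[ℝ] F, ‖L - M p‖ < ε → Injective L := by
  obtain ⟨C, hC0, hC⟩ := exists_forall_norm_le_mul_norm hX hM hinj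
  refine ⟨(C + 1)⁻¹, by positivity, fun p hp L hL => ?_⟩
  rw [injective_iff_map_eq_zero]
  intro z hz
  by_contra hz0
  have hzpos : 0 < ‖z‖ := norm_pos_iff.2 hz0
  have h1 : ‖M p z‖ ≤ (C + 1)⁻¹ * ‖z‖ := by
    have : M p z = -((L - M p) z) := by simp [hz]
    rw [this, norm_neg]
    exact (ContinuousLinearMap.le_opNorm _ _).trans (by gcongr)
  have h2 : ‖z‖ ≤ C * ((C + 1)⁻¹ * ‖z‖) := (hC p hp z).trans (by gcongr)
  have h3 : C * ((C + 1)⁻¹ * ‖z‖) < ‖z‖ := by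
    rw [← mul_assoc, ← div_eq_mul_inv]
    have : C / (C + 1) < 1 := by rw [div_lt_one (by positivity)]; linarith
    nlinarith
  linarith

/-- A family of injective linear maps over a contractible compact set admits a continuous
field transverse to the images. -/
lemma exists_continuousOn_forall_notMem_range {T E F : Type*} [PseudoMetricSpace T]
    [NormedAddCommGroup E] [NormedSpace ℝ E] [FiniteDimensional ℝ E]
    [NormedAddCommGroup F] [NormedSpace ℝ F] [FiniteDimensional ℝ F]
    (hEF : Module.finrank ℝ E < Module.finrank ℝ F)
    {X : Set T} (hX : IsCompact X) {Γ : T × ℝ → T} (hΓ : ContinuousOn Γ (X ×ˢ Icc 0 1))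
    (hΓX : MapsTo Γ (X ×ˢ Icc 0 1) X) {p₀ : T} (hΓ0 : ∀ p ∈ X, Γ (p, 0) = p₀)
    (hΓ1 : ∀ p ∈ X, Γ (p, 1) = p) {L : T → E →L[ℝ] F} (hL : ContinuousOn L X)
    (hinj : ∀ p ∈ X, Injective (L p)) :
    ∃ c : T → F, ContinuousOn c X ∧ ∀ p ∈ X, c p ∉ range (L p) := by
  obtain ⟨Λ, hΛ, hΛl⟩ := exists_continuousOn_leftInverse E F
  have hLΓ : ContinuousOn (fun z => L (Γ z)) (X ×ˢ Icc (0 : ℝ) 1) := hL.comp hΓ hΓX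
  have hK : IsCompact (X ×ˢ Icc (0 : ℝ) 1) := hX.prod isCompact_Icc
  have hΛΓ : ContinuousOn (fun z => Λ (L (Γ z))) (X ×ˢ Icc (0 : ℝ) 1) :=
    hΛ.comp hLΓ fun z hz => hinj _ (hΓX hz)
  obtain ⟨C₀, hC₀⟩ := hK.exists_bound_of_continuousOn hΛΓ
  obtain ⟨C, hC0, hC⟩ : ∃ C, 0 ≤ C ∧ ∀ z ∈ X ×ˢ Icc (0 : ℝ) 1, ‖Λ (L (Γ z))‖ ≤ C :=
    ⟨max C₀ 0, le_max_right _ _, fun z hz => (hC₀ z hz).trans (le_max_left _ _)⟩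
  obtain ⟨δ, hδ, hδL⟩ := Metric.uniformContinuousOn_iff.1
    (hK.uniformContinuousOn_of_continuous hLΓ) (C + 1)⁻¹ (by positivity)
  obtain ⟨N, hN⟩ := exists_nat_one_div_lt hδ
  suffices h : ∀ k : ℕ, k ≤ N + 1 → ∃ c : T → F, ContinuousOn c X ∧
      ∀ p ∈ X, c p ∉ range (L (Γ (p, (k : ℝ) / (N + 1)))) by
    obtain ⟨c, hc, hcn⟩ := h (N + 1) le_rfl
    refine ⟨c, hc, fun p hp => ?_⟩
    have := hcn p hp
    rwa [Nat.cast_add, Nat.cast_one, div_self (by positivity), hΓ1 p hp] at this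
  intro k
  induction k with
  | zero =>
    intro _
    obtain ⟨v, hv⟩ : ∃ v, v ∉ range (L p₀) := by
      by_contra! h
      have hsurj : Surjective (L p₀ : E →ₗ[ℝ] F) := fun v => h v
      exact absurd (LinearMap.finrank_le_finrank_of_surjective hsurj) (by omega)
    refine ⟨fun _ => v, continuousOn_const, fun p hp => ?_⟩
    simpa [hΓ0 p hp] using hv
  | succ k ih =>
    intro hk
    obtain ⟨c, hc, hcn⟩ := ih (by omega)
    set s : ℝ := (k : ℝ) / (N + 1) with hs
    set s' : ℝ := ((k + 1 : ℕ) : ℝ) / (N + 1) with hs'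
    have hNpos : (0 : ℝ) < N + 1 := by positivity
    have hkN : ((k + 1 : ℕ) : ℝ) ≤ N + 1 := by exact_mod_cast hk
    have hss : s' - s = 1 / (N + 1) := by rw [hs, hs']; push_cast; ring
    have hsI : s ∈ Icc (0 : ℝ) 1 := by
      refine ⟨by positivity, ?_⟩
      rw [hs, div_le_one hNpos]; push_cast at hkN; linarith
    have hsI' : s' ∈ Icc (0 : ℝ) 1 := ⟨by positivity, by rwa [hs', div_le_one hNpos]⟩
    have hcs : ∀ u ∈ Icc (0 : ℝ) 1, ContinuousOn (fun p : T => (p, u)) X :=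
      fun u _ => by fun_prop
    have hmaps : ∀ u ∈ Icc (0 : ℝ) 1, MapsTo (fun p : T => (p, u)) X (X ×ˢ Icc 0 1) :=
      fun u hu p hp => ⟨hp, hu⟩
    refine ⟨fun p => c p + (L (Γ (p, s')) - L (Γ (p, s))) (Λ (L (Γ (p, s))) (c p)), ?_, ?_⟩
    · have h1 := hLΓ.comp (hcs s hsI) (hmaps s hsI)
      have h2 := hLΓ.comp (hcs s' hsI') (hmaps s' hsI')
      have h3 := hΛΓ.comp (hcs s hsI) (hmaps s hsI)
      exact hc.add ((h2.sub h1).clm_apply (h3.clm_apply hc))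
    · rintro p hp ⟨w, hw⟩
      beta_reduce at hw
      have hz : (p, s) ∈ X ×ˢ Icc (0 : ℝ) 1 := ⟨hp, hsI⟩
      have hz' : (p, s') ∈ X ×ˢ Icc (0 : ℝ) 1 := ⟨hp, hsI'⟩
      refine hcn p hp ⟨w, ?_⟩
      set D := L (Γ (p, s')) - L (Γ (p, s)) with hD
      have hDn : ‖D‖ < (C + 1)⁻¹ := by
        rw [hD, ← dist_eq_norm]
        refine hδL _ hz' _ hz ?_
        rw [Prod.dist_eq, dist_self, Real.dist_eq, hss, abs_of_pos (by positivity)]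
        simpa [hδ] using hN
      set r := c p - L (Γ (p, s)) w with hr
      have hrD : r = -(D (Λ (L (Γ (p, s))) r)) := by
        have h1 : Λ (L (Γ (p, s))) (L (Γ (p, s)) w) = w := hΛl _ (hinj _ (hΓX hz)) w
        have h2 : D (Λ (L (Γ (p, s))) r) = D (Λ (L (Γ (p, s))) (c p)) - D w := by
          rw [hr, map_sub, h1, map_sub]
        have h3 : D w = L (Γ (p, s')) w - L (Γ (p, s)) w := by rw [hD]; rfl
        rw [h2, h3, hw, hr]
        abel
      have hrn : ‖r‖ ≤ (C + 1)⁻¹ * (C * ‖r‖) := by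
        conv_lhs => rw [hrD, norm_neg]
        refine (D.le_opNorm _).trans ?_
        gcongr
        exact (ContinuousLinearMap.le_opNorm _ _).trans (by gcongr; exact hC _ hz)
      have hr0 : r = 0 := by
        by_contra h
        have hpos : 0 < ‖r‖ := norm_pos_iff.2 h
        rw [inv_mul_eq_div, le_div_iff₀ (by positivity)] at hrn
        nlinarith
      rw [hr, sub_eq_zero] at hr0
      exact hr0.symm

/-- Continuous functions on a closed set are uniformly approximated by smooth functions. -/
lemma exists_contDiff_forall_dist_lt {E F : Type*}
    [NormedAddCommGroup E] [NormedSpace ℝ E] [FiniteDimensional ℝ E]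
    [NormedAddCommGroup F] [NormedSpace ℝ F]
    {X : Set E} (hX : IsClosed X) {c : E → F} (hc : ContinuousOn c X) {ε : ℝ} (hε : 0 < ε) :
    ∃ d : E → F, ContDiff ℝ (⊤ : ℕ∞) d ∧ ∀ p ∈ X, dist (d p) (c p) < ε := by
  obtain ⟨g, hg⟩ := exists_contMDiffMap_forall_mem_convex_of_local_const (n := (⊤ : ℕ∞))
    (modelWithCornersSelf ℝ E) (t := fun p => {v : F | p ∈ X → dist v (c p) < ε})
    (fun p => by
      by_cases hp : p ∈ X
      · convert convex_ball (c p) ε using 1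
        ext v
        simp [hp]
      · simpa [hp] using convex_univ)
    (fun p => by
      by_cases hp : p ∈ X
      · refine ⟨c p, ?_⟩
        have := eventually_nhdsWithin_iff.1 ((hc p hp).eventually (ball_mem_nhds (c p) hε))
        filter_upwards [this] with y hy hyX
        rw [dist_comm]
        exact hy hyX
      · refine ⟨0, ?_⟩
        filter_upwards [hX.isOpen_compl.mem_nhds hp] with y hy hyX
        exact absurd hyX hy)
  exact ⟨g, g.contMDiff.contDiff, fun p hp => hg p hp⟩

/-- The spatial derivative of a map of space and time. -/
noncomputable def spaceFDeriv {E F : Type*} [NormedAddCommGroup E] [NormedSpace ℝ E]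
    [NormedAddCommGroup F] [NormedSpace ℝ F] (g : E × ℝ → F) (p : E × ℝ) : E →L[ℝ] F :=
  (fderiv ℝ g p).comp (ContinuousLinearMap.inl ℝ E ℝ)

lemma continuous_spaceFDeriv {E F : Type*} [NormedAddCommGroup E] [NormedSpace ℝ E]
    [NormedAddCommGroup F] [NormedSpace ℝ F] {g : E × ℝ → F} (hg : ContDiff ℝ (⊤ : ℕ∞) g) :
    Continuous (spaceFDeriv g) :=
  (hg.continuous_fderiv (by simp)).clm_comp continuous_const

/-- The projection of `ℝⁿ` killing the coordinates in `S`. -/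
noncomputable def killCoords {n : ℕ} (S : Finset (Fin n)) : (Fin n → ℝ) →L[ℝ] (Fin n → ℝ) :=
  ContinuousLinearMap.pi fun j => if j ∈ S then 0 else ContinuousLinearMap.proj j

lemma killCoords_apply {n : ℕ} (S : Finset (Fin n)) (v : Fin n → ℝ) (j : Fin n) :
    killCoords S v j = if j ∈ S then 0 else v j := by
  rw [killCoords, ContinuousLinearMap.pi_apply]
  split_ifs <;> rfl

lemma killCoords_singleton_apply {n : ℕ} (i : Fin n) (v : Fin n → ℝ) :
    killCoords {i} v = v - v i • Pi.single i 1 := by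
  ext j
  rw [killCoords_apply]
  by_cases h : j = i
  · subst h; simp
  · simp [h]

/-- The corrugated linear map is injective at every phase `s` of the oscillation. -/
lemma injective_corrugated {n : ℕ} {F : Type*} [NormedAddCommGroup F] [NormedSpace ℝ F]
    {L θ : (Fin n → ℝ) →L[ℝ] F} {c : F} {C V R r s : ℝ} (i : Fin n)
    (hC0 : 0 ≤ C) (hV : ‖θ (Pi.single i 1)‖ ≤ V) (hV0 : 0 ≤ V)
    (hC : ∀ (u : Fin n → ℝ) (a : ℝ), ‖(u, a)‖ ≤ C * ‖L u + a • c‖)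
    (hR : 4 * (C * V + 1) ≤ R) (hr : r = 1 ∨ θ (Pi.single i 1) = 0) :
    Injective (L + (ContinuousLinearMap.proj i : (Fin n → ℝ) →L[ℝ] ℝ).smulRight
      (-θ (Pi.single i 1) + (r ^ 2 * R * (1 - 2 * s ^ 2)) • L (Pi.single i 1)
        + (r * R * s) • c)) := by
  rw [injective_iff_map_eq_zero]
  intro w hw
  have hCV : 0 ≤ C * V := mul_nonneg hC0 hV0
  have hw' : L w + w i • (-θ (Pi.single i 1) + (r ^ 2 * R * (1 - 2 * s ^ 2)) • L (Pi.single i 1)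
        + (r * R * s) • c) = 0 := hw
  by_cases hwi : w i = 0
  · rw [hwi, zero_smul, add_zero] at hw'
    have h := hC w 0
    rw [hw'] at h
    simp only [zero_smul, add_zero, norm_zero, mul_zero, norm_le_zero_iff, Prod.mk_eq_zero] at h
    exact h.1
  exfalso
  have key := hC ((w i)⁻¹ • w + (r ^ 2 * R * (1 - 2 * s ^ 2)) • Pi.single i 1) (r * R * s)
  have heq : L ((w i)⁻¹ • w + (r ^ 2 * R * (1 - 2 * s ^ 2)) • Pi.single i 1) + (r * R * s) • c
      = θ (Pi.single i 1) := by
    have h : (w i)⁻¹ • (L w + w i • (-θ (Pi.single i 1) +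
      (r ^ 2 * R * (1 - 2 * s ^ 2)) • L (Pi.single i 1) + (r * R * s) • c)) = 0 := by
      rw [hw', smul_zero]
    rw [smul_add, inv_smul_smul₀ hwi] at h
    rw [map_add, map_smul, map_smul]
    rw [← sub_eq_zero, ← h]
    abel
  rw [heq] at key
  have h1 : |1 + r ^ 2 * R * (1 - 2 * s ^ 2)| ≤ C * ‖θ (Pi.single i 1)‖ := by
    refine le_trans ?_ ((norm_fst_le _).trans key)
    refine le_trans (le_of_eq ?_) (norm_le_pi_norm _ i)
    simp [hwi]
  have h2 : |r * R * s| ≤ C * ‖θ (Pi.single i 1)‖ := (norm_snd_le _).trans key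
  rcases hr with rfl | h0
  · have hV' : C * ‖θ (Pi.single i 1)‖ ≤ C * V := by gcongr
    have h3 := abs_le.1 (h1.trans hV')
    have h4 : |R * s| ≤ R / 4 := by
      have := h2.trans hV'
      rw [one_mul] at this
      linarith
    have hRpos : 0 < R := by linarith
    rw [abs_mul, abs_of_pos hRpos] at h4
    have h5 : |s| ≤ 1 / 4 := by
      by_contra! h
      nlinarith
    have h6 : s ^ 2 ≤ 1 / 16 := by
      rw [← sq_abs]
      nlinarith [abs_nonneg s]
    nlinarith [h3.2]
  · rw [h0, norm_zero, mul_zero] at h1 h2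
    have h3 := abs_eq_zero.1 (le_antisymm h1 (abs_nonneg _))
    have h4 := abs_eq_zero.1 (le_antisymm h2 (abs_nonneg _))
    have hRpos : 0 < R := by linarith
    have h5 : r ^ 2 * R * s ^ 2 = 0 := by
      have : R * (r ^ 2 * R * s ^ 2) = 0 := by linear_combination (r * R * s) * h4
      exact (mul_eq_zero.1 this).resolve_left hRpos.ne'
    nlinarith [mul_nonneg (sq_nonneg r) hRpos.le]

/-- The spatial derivative of an oscillating perturbation. -/
lemma spaceFDeriv_corrugation {n : ℕ} {F : Type*} [NormedAddCommGroup F] [NormedSpace ℝ F]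
    {β γ : (Fin n → ℝ) × ℝ → F} (hβ : ContDiff ℝ (⊤ : ℕ∞) β) (hγ : ContDiff ℝ (⊤ : ℕ∞) γ)
    {ω : ℝ} (hω : ω ≠ 0) (i : Fin n) (p : (Fin n → ℝ) × ℝ) :
    spaceFDeriv (fun q : (Fin n → ℝ) × ℝ =>
      ω⁻¹ • (Real.sin (2 * ω * q.1 i) • β q - Real.cos (ω * q.1 i) • γ q)) p =
    (ContinuousLinearMap.proj i : (Fin n → ℝ) →L[ℝ] ℝ).smulRight
      ((2 * (1 - 2 * Real.sin (ω * p.1 i) ^ 2)) • β p + Real.sin (ω * p.1 i) • γ p) +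
    ω⁻¹ • (Real.sin (2 * ω * p.1 i) • spaceFDeriv β p
      - Real.cos (ω * p.1 i) • spaceFDeriv γ p) := by
  have hx : HasFDerivAt (fun q : (Fin n → ℝ) × ℝ => q.1 i)
      ((ContinuousLinearMap.proj i : (Fin n → ℝ) →L[ℝ] ℝ).comp
        (ContinuousLinearMap.fst ℝ (Fin n → ℝ) ℝ)) p :=
    ((ContinuousLinearMap.proj i : (Fin n → ℝ) →L[ℝ] ℝ).comp
        (ContinuousLinearMap.fst ℝ (Fin n → ℝ) ℝ)).hasFDerivAt
  have hβ' := (hβ.differentiable (by simp) p).hasFDerivAt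
  have hγ' := (hγ.differentiable (by simp) p).hasFDerivAt
  have h := ((((hx.const_mul (2 * ω)).sin.fun_smul hβ').sub
    ((hx.const_mul ω).cos.fun_smul hγ')).const_smul ω⁻¹)
  have h' := h.fderiv
  have h2 : Real.cos (2 * ω * p.1 i) = 1 - 2 * Real.sin (ω * p.1 i) ^ 2 := by
    rw [mul_assoc, Real.cos_two_mul, Real.cos_sq']; ring
  rw [spaceFDeriv, spaceFDeriv, spaceFDeriv]
  refine (congrArg (fun D : (Fin n → ℝ) × ℝ →L[ℝ] F =>
    D.comp (ContinuousLinearMap.inl ℝ (Fin n → ℝ) ℝ)) h').trans ?_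
  ext1 v
  simp only [ContinuousLinearMap.comp_apply, add_apply,
    sub_apply, smul_apply,
    ContinuousLinearMap.smulRight_apply, ContinuousLinearMap.inl_apply,
    ContinuousLinearMap.proj_apply, ContinuousLinearMap.coe_fst', h2, smul_eq_mul]
  match_scalars <;> field_simp

/-- One step of convex integration: a smooth perturbation supported away from `B` turns the
`i`-th column of a formal derivative into a genuine partial derivative. -/
lemma exists_corrugation_step {n : ℕ} {F : Type*} [NormedAddCommGroup F] [NormedSpace ℝ F]
    [FiniteDimensional ℝ F] {X B W : Set ((Fin n → ℝ) × ℝ)} (hX : IsCompact X)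
    (hB : IsClosed B) (hW : IsOpen W) (hBW : B ⊆ W)
    {A θ : (Fin n → ℝ) × ℝ → (Fin n → ℝ) →L[ℝ] F} (hA : ContinuousOn A X)
    (hθ : ContinuousOn θ X) (hinj : ∀ p ∈ X, Injective (A p + θ p))
    (hθW : ∀ p ∈ X ∩ W, θ p = 0) {c : (Fin n → ℝ) × ℝ → F} (hc : ContinuousOn c X)
    (hcn : ∀ p ∈ X, c p ∉ range (A p + θ p)) (i : Fin n) :
    ∃ g : (Fin n → ℝ) × ℝ → F, ContDiff ℝ (⊤ : ℕ∞) g ∧ (∀ p ∈ B, g =ᶠ[nhds p] 0) ∧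
      ∀ p ∈ X, Injective (A p + spaceFDeriv g p + (θ p).comp (killCoords {i})) := by
  let e : Fin n → ℝ := Pi.single i 1
  have hb : ContinuousOn (fun p => (A p + θ p) e) X := (hA.add hθ).clm_apply continuousOn_const
  have hθe : ContinuousOn (fun p => θ p e) X := hθ.clm_apply continuousOn_const
  obtain ⟨C, hC0, hC⟩ : ∃ C, 0 ≤ C ∧ ∀ p ∈ X, ∀ z : (Fin n → ℝ) × ℝ,
      ‖z‖ ≤ C * ‖((A p + θ p).coprod (ContinuousLinearMap.toSpanSingleton ℝ (c p))) z‖ := by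
    refine exists_forall_norm_le_mul_norm hX (M := fun p =>
      (A p + θ p).coprod (ContinuousLinearMap.toSpanSingleton ℝ (c p))) ?_ ?_
    · have h1 : ContinuousOn (fun p => (A p + θ p).comp
          (ContinuousLinearMap.fst ℝ (Fin n → ℝ) ℝ) +
          (ContinuousLinearMap.snd ℝ (Fin n → ℝ) ℝ).smulRight (c p)) X :=
        ((hA.add hθ).clm_comp continuousOn_const).add
          (((ContinuousLinearMap.smulRightL ℝ ((Fin n → ℝ) × ℝ) F
            (ContinuousLinearMap.snd ℝ (Fin n → ℝ) ℝ)).continuous).comp_continuousOn hc)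
      refine h1.congr fun p _ => ?_
      ext <;> simp
    · intro p hp
      rw [injective_iff_map_eq_zero]
      rintro ⟨u, a⟩ hz
      have hz' : (A p + θ p) u + a • c p = 0 := hz
      have ha : a = 0 := by
        by_contra ha
        refine hcn p hp ⟨-(a⁻¹ • u), ?_⟩
        rw [map_neg, map_smul, eq_neg_of_add_eq_zero_left hz', smul_neg, neg_neg,
          inv_smul_smul₀ ha]
      subst ha
      rw [zero_smul, add_zero] at hz'
      rw [Prod.mk_eq_zero]
      exact ⟨(injective_iff_map_eq_zero _).1 (hinj p hp) u hz', rfl⟩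
  obtain ⟨V₀, hV₀⟩ := hX.exists_bound_of_continuousOn hθe
  obtain ⟨V, hV0, hV⟩ : ∃ V, 0 ≤ V ∧ ∀ p ∈ X, ‖θ p e‖ ≤ V :=
    ⟨max V₀ 0, le_max_right _ _, fun p hp => (hV₀ p hp).trans (le_max_left _ _)⟩
  obtain ⟨R, hR⟩ : ∃ R, 4 * (C * V + 1) ≤ R := ⟨_, le_rfl⟩
  have hRpos : 0 < R := by nlinarith [mul_nonneg hC0 hV0]
  obtain ⟨ρ, hρ0, hρ1, hρI⟩ := exists_contMDiffMap_zero_one_nhds_of_isClosed (n := (⊤ : ℕ∞))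
    (modelWithCornersSelf ℝ ((Fin n → ℝ) × ℝ)) hB hW.isClosed_compl
    (disjoint_compl_right_iff_subset.2 hBW)
  have hρs : ContDiff ℝ (⊤ : ℕ∞) ρ := ρ.contMDiff.contDiff
  -- the corrugated maps, parametrised by the phase
  let M : ((Fin n → ℝ) × ℝ) × ℝ → (Fin n → ℝ) →L[ℝ] F := fun z =>
    (A z.1 + θ z.1) + (ContinuousLinearMap.proj i : (Fin n → ℝ) →L[ℝ] ℝ).smulRight
      (-θ z.1 e + (ρ z.1 ^ 2 * R * (1 - 2 * z.2 ^ 2)) • (A z.1 + θ z.1) e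
        + (ρ z.1 * R * z.2) • c z.1)
  have hMc : ContinuousOn M (X ×ˢ Icc (-1 : ℝ) 1) := by
    have hfst : MapsTo Prod.fst (X ×ˢ Icc (-1 : ℝ) 1) X := fun z hz => hz.1
    have hf : ContinuousOn (Prod.fst : ((Fin n → ℝ) × ℝ) × ℝ → _) (X ×ˢ Icc (-1 : ℝ) 1) :=
      continuousOn_fst
    have hρc : Continuous ρ := hρs.continuous
    refine ((hA.add hθ).comp hf hfst).add
      (((ContinuousLinearMap.smulRightL ℝ (Fin n → ℝ) F
        (ContinuousLinearMap.proj i)).continuous).comp_continuousOn ?_)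
    refine ((hθe.comp hf hfst).neg.add (ContinuousOn.smul ?_ (hb.comp hf hfst))).add
      (ContinuousOn.smul ?_ (hc.comp hf hfst))
    · exact Continuous.continuousOn (by fun_prop)
    · exact Continuous.continuousOn (by fun_prop)
  have hMinj : ∀ z ∈ X ×ˢ Icc (-1 : ℝ) 1, Injective (M z) := by
    rintro ⟨p, s⟩ ⟨hp, -⟩
    refine injective_corrugated i hC0 (hV p hp) hV0 (fun u a => by simpa using hC p hp (u, a))
      hR ?_
    by_cases hpW : p ∈ W
    · exact Or.inr (by rw [hθW p ⟨hp, hpW⟩]; rfl)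
    · exact Or.inl (hρ1.self_of_nhdsSet p hpW)
  obtain ⟨ε, hε, hεM⟩ := exists_forall_norm_sub_lt_injective (hX.prod isCompact_Icc) hMc hMinj
  obtain ⟨b', hb's, hb'⟩ := exists_contDiff_forall_dist_lt hX.isClosed hb
    (show 0 < ε / (4 * R) by positivity)
  obtain ⟨c', hc's, hc'⟩ := exists_contDiff_forall_dist_lt hX.isClosed hc
    (show 0 < ε / (4 * R) by positivity)
  let β : (Fin n → ℝ) × ℝ → F := fun p => (ρ p ^ 2 * R / 2) • b' p
  let γ : (Fin n → ℝ) × ℝ → F := fun p => (ρ p * R) • c' p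
  have hβ : ContDiff ℝ (⊤ : ℕ∞) β := (((hρs.pow 2).mul contDiff_const).div_const 2).smul hb's
  have hγ : ContDiff ℝ (⊤ : ℕ∞) γ := (hρs.mul contDiff_const).smul hc's
  obtain ⟨D₁, hD₁⟩ := hX.exists_bound_of_continuousOn (continuous_spaceFDeriv hβ).continuousOn
  obtain ⟨D₂, hD₂⟩ := hX.exists_bound_of_continuousOn (continuous_spaceFDeriv hγ).continuousOn
  obtain ⟨ω, hω0, hω⟩ : ∃ ω : ℝ, 0 < ω ∧ ω⁻¹ * (|D₁| + |D₂|) < ε / 2 := by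
    refine ⟨2 * (|D₁| + |D₂| + 1) / ε, by positivity, ?_⟩
    rw [inv_div, div_mul_eq_mul_div, div_lt_iff₀ (by positivity)]
    nlinarith
  let g : (Fin n → ℝ) × ℝ → F := fun q =>
      ω⁻¹ • (Real.sin (2 * ω * q.1 i) • β q - Real.cos (ω * q.1 i) • γ q)
  have hxi : ContDiff ℝ (⊤ : ℕ∞) (fun q : (Fin n → ℝ) × ℝ => q.1 i) :=
    (contDiff_apply ℝ ℝ i).comp contDiff_fst
  refine ⟨g, ?_, ?_, ?_⟩
  · exact (((contDiff_const.mul hxi).sin.smul hβ).sub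
      ((contDiff_const.mul hxi).cos.smul hγ)).const_smul ω⁻¹
  · intro p hp
    filter_upwards [hρ0.filter_mono (nhds_le_nhdsSet hp)] with q hq
    simp [g, β, γ, hq]
  · intro p hp
    set s := Real.sin (ω * p.1 i) with hs
    have hsI : s ∈ Icc (-1 : ℝ) 1 := Real.sin_mem_Icc _
    refine hεM (p, s) ⟨hp, hsI⟩ _ ?_
    have hsp : spaceFDeriv g p = _ := spaceFDeriv_corrugation hβ hγ hω0.ne' i p
    have hdiff : A p + spaceFDeriv g p + (θ p).comp (killCoords {i}) - M (p, s) =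
        (ContinuousLinearMap.proj i : (Fin n → ℝ) →L[ℝ] ℝ).smulRight
          ((ρ p ^ 2 * R * (1 - 2 * s ^ 2)) • (b' p - (A p + θ p) e)
            + (ρ p * R * s) • (c' p - c p)) +
        ω⁻¹ • (Real.sin (2 * ω * p.1 i) • spaceFDeriv β p
          - Real.cos (ω * p.1 i) • spaceFDeriv γ p) := by
      rw [hsp]
      ext1 v
      have hk : (θ p) (killCoords {i} v) = θ p v - v i • θ p e := by
        rw [killCoords_singleton_apply, map_sub, map_smul]
      simp only [M, β, γ, ContinuousLinearMap.comp_apply, add_apply, sub_apply, smul_apply,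
        ContinuousLinearMap.smulRight_apply, ContinuousLinearMap.proj_apply, hk, ← hs]
      module
    rw [hdiff]
    have hρp : |ρ p| ≤ 1 := abs_le.2 ⟨by linarith [(hρI p).1], (hρI p).2⟩
    have hs1 : |s| ≤ 1 := abs_le.2 hsI
    have hs2 : |1 - 2 * s ^ 2| ≤ 1 := by
      have : s ^ 2 ≤ 1 := (sq_le_one_iff_abs_le_one s).2 hs1
      exact abs_le.2 ⟨by linarith, by nlinarith [sq_nonneg s]⟩
    have hn1 : ‖(ρ p ^ 2 * R * (1 - 2 * s ^ 2)) • (b' p - (A p + θ p) e)‖ ≤ ε / 4 := by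
      rw [norm_smul, Real.norm_eq_abs, abs_mul, abs_mul, abs_pow, abs_of_pos hRpos,
        ← dist_eq_norm]
      calc |ρ p| ^ 2 * R * |1 - 2 * s ^ 2| * dist (b' p) ((A p + θ p) e)
          ≤ 1 ^ 2 * R * 1 * (ε / (4 * R)) := by
            gcongr
            exact (hb' p hp).le
        _ = ε / 4 := by field_simp
    have hn2 : ‖(ρ p * R * s) • (c' p - c p)‖ ≤ ε / 4 := by
      rw [norm_smul, Real.norm_eq_abs, abs_mul, abs_mul, abs_of_pos hRpos, ← dist_eq_norm]
      calc |ρ p| * R * |s| * dist (c' p) (c p)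
          ≤ 1 * R * 1 * (ε / (4 * R)) := by
            gcongr
            exact (hc' p hp).le
        _ = ε / 4 := by field_simp
    have hn3 : ‖(ContinuousLinearMap.proj i : (Fin n → ℝ) →L[ℝ] ℝ).smulRight
          ((ρ p ^ 2 * R * (1 - 2 * s ^ 2)) • (b' p - (A p + θ p) e)
            + (ρ p * R * s) • (c' p - c p))‖ ≤ ε / 2 := by
      refine ContinuousLinearMap.opNorm_le_bound _ (by positivity) fun v => ?_
      rw [ContinuousLinearMap.smulRight_apply, norm_smul, ContinuousLinearMap.proj_apply, mul_comm]
      refine mul_le_mul ?_ (norm_le_pi_norm v i) (norm_nonneg _) (by positivity)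
      exact (norm_add_le _ _).trans (by linarith)
    have hn4 : ‖ω⁻¹ • (Real.sin (2 * ω * p.1 i) • spaceFDeriv β p
          - Real.cos (ω * p.1 i) • spaceFDeriv γ p)‖ < ε / 2 := by
      refine lt_of_le_of_lt ?_ hω
      rw [norm_smul, Real.norm_eq_abs, abs_of_pos (inv_pos.2 hω0)]
      gcongr
      refine (norm_sub_le _ _).trans (add_le_add ?_ ?_)
      · rw [norm_smul, Real.norm_eq_abs, ← one_mul |D₁|]
        exact mul_le_mul (Real.abs_sin_le_one _) ((hD₁ p hp).trans (le_abs_self _))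
          (norm_nonneg _) zero_le_one
      · rw [norm_smul, Real.norm_eq_abs, ← one_mul |D₂|]
        exact mul_le_mul (Real.abs_cos_le_one _) ((hD₂ p hp).trans (le_abs_self _))
          (norm_nonneg _) zero_le_one
    exact (norm_add_le _ _).trans_lt (by linarith)

/-- The relative parametric h-principle for immersions: a formal derivative `A + θ` over a
contractible compact set becomes holonomic after adding a perturbation vanishing near `B`. -/
lemma exists_injective_add_spaceFDeriv {n : ℕ} {F : Type*} [NormedAddCommGroup F]
    [NormedSpace ℝ F] [FiniteDimensional ℝ F] (hn : n < Module.finrank ℝ F)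
    {X B W : Set ((Fin n → ℝ) × ℝ)} (hX : IsCompact X)
    (hB : IsClosed B) (hW : IsOpen W) (hBW : B ⊆ W)
    {Γ : ((Fin n → ℝ) × ℝ) × ℝ → (Fin n → ℝ) × ℝ} (hΓ : ContinuousOn Γ (X ×ˢ Icc 0 1))
    (hΓX : MapsTo Γ (X ×ˢ Icc 0 1) X) {p₀ : (Fin n → ℝ) × ℝ} (hΓ0 : ∀ p ∈ X, Γ (p, 0) = p₀)
    (hΓ1 : ∀ p ∈ X, Γ (p, 1) = p)
    {A θ : (Fin n → ℝ) × ℝ → (Fin n → ℝ) →L[ℝ] F} (hA : ContinuousOn A X)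
    (hθ : ContinuousOn θ X) (hinj : ∀ p ∈ X, Injective (A p + θ p))
    (hθW : ∀ p ∈ X ∩ W, θ p = 0) :
    ∃ g : (Fin n → ℝ) × ℝ → F, ContDiff ℝ (⊤ : ℕ∞) g ∧ (∀ p ∈ B, g =ᶠ[nhds p] 0) ∧
      ∀ p ∈ X, Injective (A p + spaceFDeriv g p) := by
  suffices h : ∀ S : Finset (Fin n), ∃ g : (Fin n → ℝ) × ℝ → F, ContDiff ℝ (⊤ : ℕ∞) g ∧
      (∀ p ∈ B, g =ᶠ[nhds p] 0) ∧
      ∀ p ∈ X, Injective (A p + spaceFDeriv g p + (θ p).comp (killCoords S)) by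
    obtain ⟨g, hg, hgB, hgX⟩ := h Finset.univ
    refine ⟨g, hg, hgB, fun p hp => ?_⟩
    have h0 : killCoords (Finset.univ : Finset (Fin n)) = 0 := by
      ext v j
      rw [killCoords_apply]
      simp
    have := hgX p hp
    rwa [h0, ContinuousLinearMap.comp_zero, add_zero] at this
  intro S
  induction S using Finset.induction_on with
  | empty =>
    refine ⟨0, contDiff_const, fun p _ => Filter.EventuallyEq.rfl, fun p hp => ?_⟩
    have h0 : killCoords (∅ : Finset (Fin n)) = ContinuousLinearMap.id ℝ _ := by
      ext1 v
      ext j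
      rw [killCoords_apply]
      simp
    have h1 : spaceFDeriv (0 : (Fin n → ℝ) × ℝ → F) p = 0 := by
      rw [spaceFDeriv, fderiv_zero]
      exact ContinuousLinearMap.zero_comp _
    rw [h0, h1, add_zero, ContinuousLinearMap.comp_id]
    exact hinj p hp
  | insert i S hi ih =>
    obtain ⟨g, hg, hgB, hgX⟩ := ih
    have hA' : ContinuousOn (fun p => A p + spaceFDeriv g p) X :=
      hA.add (continuous_spaceFDeriv hg).continuousOn
    have hθ' : ContinuousOn (fun p => (θ p).comp (killCoords S)) X :=
      hθ.clm_comp continuousOn_const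
    obtain ⟨c, hc, hcn⟩ := exists_continuousOn_forall_notMem_range (by simpa using hn) hX hΓ hΓX
      hΓ0 hΓ1 (hA'.add hθ') hgX
    obtain ⟨g', hg', hgB', hgX'⟩ := exists_corrugation_step hX hB hW hBW hA' hθ' hgX
      (fun p hp => by rw [hθW p hp, ContinuousLinearMap.zero_comp]) hc hcn i
    refine ⟨g + g', hg.add hg', fun p hp => ?_, fun p hp => ?_⟩
    · simpa using (hgB p hp).add (hgB' p hp)
    · have h1 : spaceFDeriv (g + g') p = spaceFDeriv g p + spaceFDeriv g' p := by
        rw [spaceFDeriv, fderiv_add (hg.differentiable (by simp) p)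
          (hg'.differentiable (by simp) p)]
        exact ContinuousLinearMap.add_comp _ _ _
      have h2 : (killCoords S).comp (killCoords {i}) = killCoords (insert i S) := by
        ext1 v
        ext j
        rw [ContinuousLinearMap.comp_apply]
        simp only [killCoords_apply, Finset.mem_insert, Finset.mem_singleton]
        split_ifs <;> simp_all
      have := hgX' p hp
      rwa [ContinuousLinearMap.comp_assoc, h2, add_assoc (A p), ← h1] at this

/-- The relative parametric h-principle for immersions, for a family `K` of injective linear
maps agreeing with `A` on `B`. -/
lemma exists_injective_add_spaceFDeriv_of_eqOn {n : ℕ} {F : Type*} [NormedAddCommGroup F]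
    [NormedSpace ℝ F] [FiniteDimensional ℝ F] (hn : n < Module.finrank ℝ F)
    {X B : Set ((Fin n → ℝ) × ℝ)} (hX : IsCompact X) (hB : IsClosed B) (hBX : B ⊆ X)
    {Γ : ((Fin n → ℝ) × ℝ) × ℝ → (Fin n → ℝ) × ℝ} (hΓ : ContinuousOn Γ (X ×ˢ Icc 0 1))
    (hΓX : MapsTo Γ (X ×ˢ Icc 0 1) X) {p₀ : (Fin n → ℝ) × ℝ} (hΓ0 : ∀ p ∈ X, Γ (p, 0) = p₀)
    (hΓ1 : ∀ p ∈ X, Γ (p, 1) = p)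
    {A K : (Fin n → ℝ) × ℝ → (Fin n → ℝ) →L[ℝ] F} (hA : ContinuousOn A X)
    (hK : ContinuousOn K X) (hinj : ∀ p ∈ X, Injective (K p)) (hKA : EqOn K A B) :
    ∃ g : (Fin n → ℝ) × ℝ → F, ContDiff ℝ (⊤ : ℕ∞) g ∧ (∀ p ∈ B, g =ᶠ[nhds p] 0) ∧
      ∀ p ∈ X, Injective (A p + spaceFDeriv g p) := by
  obtain ⟨δ, hδ, hδK⟩ := exists_forall_norm_sub_lt_injective hX hK hinj
  have hθ₀ : ContinuousOn (fun p => K p - A p) X := hK.sub hA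
  let ζ : ℝ → ℝ := fun r => max 0 (min 1 (2 * r / δ - 1))
  have hζ : Continuous ζ := by fun_prop
  have hζ0 : ∀ r, r < δ / 2 → ζ r = 0 := fun r hr => by
    refine max_eq_left (min_le_of_right_le ?_)
    rw [sub_nonpos, div_le_one hδ]
    linarith
  have hζ1 : ∀ r, δ ≤ r → ζ r = 1 := fun r hr => by
    have : 1 ≤ 2 * r / δ - 1 := by
      rw [le_sub_iff_add_le, le_div_iff₀ hδ]
      linarith
    simp [ζ, min_eq_left this]
  have hζI : ∀ r, ζ r ∈ Icc (0 : ℝ) 1 := fun r =>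
    ⟨le_max_left _ _, max_le zero_le_one (min_le_left _ _)⟩
  obtain ⟨W, hW, hWX⟩ := continuousOn_iff'.1 hθ₀.norm (Iio (δ / 2)) isOpen_Iio
  refine exists_injective_add_spaceFDeriv (W := W)
    (θ := fun p => ζ ‖K p - A p‖ • (K p - A p)) hn hX hB hW ?_ hΓ hΓX hΓ0 hΓ1 hA
    ((hζ.comp_continuousOn hθ₀.norm).smul hθ₀) ?_ ?_
  · intro p hp
    have : p ∈ (fun p => ‖K p - A p‖) ⁻¹' Iio (δ / 2) ∩ X :=
      ⟨by simp [hKA hp, hδ], hBX hp⟩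
    rw [hWX] at this
    exact this.1
  · intro p hp
    rcases lt_or_ge ‖K p - A p‖ δ with h | h
    · refine hδK p hp _ ?_
      have heq : A p + ζ ‖K p - A p‖ • (K p - A p) - K p =
          (ζ ‖K p - A p‖ - 1) • (K p - A p) := by module
      rw [heq, norm_smul, Real.norm_eq_abs]
      have h1 : |ζ ‖K p - A p‖ - 1| ≤ 1 :=
        abs_le.2 ⟨by linarith [(hζI ‖K p - A p‖).1], by linarith [(hζI ‖K p - A p‖).2]⟩
      exact (mul_le_of_le_one_left (norm_nonneg _) h1).trans_lt h
    · simpa only [hζ1 _ h, one_smul, add_sub_cancel] using hinj p hp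
  · rintro p ⟨hp, hpW⟩
    have : p ∈ (fun p => ‖K p - A p‖) ⁻¹' Iio (δ / 2) ∩ X := by
      rw [hWX]; exact ⟨hpW, hp⟩
    simp only [hζ0 _ this.1, zero_smul]

lemma isCompact_upperHemi (n : ℕ) [NeZero n] : IsCompact (upperHemi n) := by
  refine Metric.isCompact_of_isClosed_isBounded ?_ ?_
  · have h1 : IsClosed {x : Fin n → ℝ | ∑ i, (x i) ^ 2 = 1} :=
      isClosed_eq (by fun_prop) continuous_const
    exact h1.inter (isClosed_le continuous_const (continuous_apply 0))
  · refine Metric.isBounded_closedBall (x := (0 : Fin n → ℝ)) (r := 1) |>.subset ?_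
    rintro x ⟨hx, -⟩
    rw [mem_closedBall_zero_iff, pi_norm_le_iff_of_nonneg zero_le_one]
    intro i
    have hx' : ∑ i, (x i) ^ 2 = 1 := hx
    have : x i ^ 2 ≤ ∑ j, (x j) ^ 2 :=
      Finset.single_le_sum (f := fun j => x j ^ 2) (fun j _ => sq_nonneg _) (Finset.mem_univ i)
    rw [hx'] at this
    exact (sq_le_one_iff_abs_le_one _).1 this

lemma equatorSet_subset_upperHemi (n : ℕ) [NeZero n] : equatorSet n ⊆ upperHemi n :=
  fun _ hx => ⟨hx.1, hx.2.ge⟩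

lemma isCompact_equatorSet (n : ℕ) [NeZero n] : IsCompact (equatorSet n) := by
  have : equatorSet n = upperHemi n ∩ {x | x 0 = 0} := by
    ext x
    exact ⟨fun h => ⟨equatorSet_subset_upperHemi n h, h.2⟩, fun h => ⟨h.1.1, h.2⟩⟩
  rw [this]
  exact (isCompact_upperHemi n).inter_right (isClosed_eq (continuous_apply 0) continuous_const)

/-- The contraction of the upper hemisphere to its pole along the vertical projection. -/
noncomputable def hemiContract (n : ℕ) [NeZero n] (x : Fin n → ℝ) (s : ℝ) : Fin n → ℝ :=
  Function.update (s • x) 0 √(1 - s ^ 2 * (1 - x 0 ^ 2))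

lemma continuous_hemiContract (n : ℕ) [NeZero n] :
    Continuous fun z : (Fin n → ℝ) × ℝ => hemiContract n z.1 z.2 := by
  unfold hemiContract
  exact (continuous_snd.smul continuous_fst).update 0 (by fun_prop)

lemma hemiContract_mem {n : ℕ} [NeZero n] {x : Fin n → ℝ} (hx : x ∈ upperHemi n) {s : ℝ}
    (hs : s ∈ Icc (0 : ℝ) 1) : hemiContract n x s ∈ upperHemi n := by
  have hx1 : ∑ i, (x i) ^ 2 = 1 := hx.1
  rw [← Finset.add_sum_erase _ _ (Finset.mem_univ (0 : Fin n))] at hx1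
  have hpos : 0 ≤ ∑ i ∈ Finset.univ.erase (0 : Fin n), x i ^ 2 :=
    Finset.sum_nonneg fun _ _ => sq_nonneg _
  have hs1 : s ^ 2 ≤ 1 := pow_le_one₀ hs.1 hs.2
  refine ⟨?_, by simp [hemiContract]⟩
  change ∑ i, (hemiContract n x s i) ^ 2 = 1
  have h : ∑ i ∈ Finset.univ.erase (0 : Fin n), hemiContract n x s i ^ 2 =
      s ^ 2 * ∑ i ∈ Finset.univ.erase (0 : Fin n), x i ^ 2 := by
    rw [Finset.mul_sum]
    refine Finset.sum_congr rfl fun i hi => ?_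
    rw [hemiContract, Function.update_of_ne (Finset.ne_of_mem_erase hi), Pi.smul_apply,
      smul_eq_mul, mul_pow]
  rw [← Finset.add_sum_erase _ _ (Finset.mem_univ (0 : Fin n)), h, hemiContract,
    Function.update_self, Real.sq_sqrt (by nlinarith [sq_nonneg s])]
  linear_combination s ^ 2 * hx1

lemma hemiContract_zero {n : ℕ} [NeZero n] (x : Fin n → ℝ) :
    hemiContract n x 0 = Pi.single 0 1 := by
  simp [hemiContract, Pi.single]

lemma hemiContract_one {n : ℕ} [NeZero n] {x : Fin n → ℝ} (hx : x ∈ upperHemi n) :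
    hemiContract n x 1 = x := by
  simp [hemiContract, Real.sqrt_sq hx.2]

/-- An `ℝⁿ`-immersion is the restriction of an immersion of an open neighbourhood. -/
lemma RnImmOn.exists_extension {n q : ℕ} {A : Set (Fin n → ℝ)} (F : RnImmOn n q A) :
    ∃ (U : Set (Fin n → ℝ)) (l : (Fin n → ℝ) → (Fin q → ℝ)), IsOpen U ∧ A ⊆ U ∧
      ContDiffOn ℝ (⊤ : ℕ∞) l U ∧ EqOn l F.f A ∧ EqOn (fderiv ℝ l) F.f' A := by
  obtain ⟨U, l, hU, hAU, hl, -, hf, hf'⟩ := F.imm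
  exact ⟨U, l, hU, hAU, hl, hf, fun x hx => by
    rw [← hf' x hx, fderivWithin_of_isOpen hU (hAU hx)]⟩

/-- A smooth map with injective differential along `A` defines an `ℝⁿ`-immersion of `A`. -/
lemma isRnImmOnData_of_contDiffOn {n q : ℕ} {A U : Set (Fin n → ℝ)}
    {l : (Fin n → ℝ) → (Fin q → ℝ)} (hU : IsOpen U) (hAU : A ⊆ U)
    (hl : ContDiffOn ℝ (⊤ : ℕ∞) l U) (hinj : ∀ x ∈ A, Injective (fderiv ℝ l x)) :
    IsRnImmOnData n q A l (fderiv ℝ l) := by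
  have hV : IsOpen (U ∩ fderiv ℝ l ⁻¹' {L | Injective L}) :=
    (hl.continuousOn_fderiv_of_isOpen hU (by simp)).isOpen_inter_preimage hU
      ContinuousLinearMap.isOpen_injective
  refine ⟨_, l, hV, fun x hx => ⟨hAU hx, hinj x hx⟩, hl.mono inter_subset_left, ?_,
    fun _ _ => rfl, fun x hx => fderivWithin_of_isOpen hV ⟨hAU hx, hinj x hx⟩⟩
  intro x hx
  rw [fderivWithin_of_isOpen hV hx]
  exact hx.2

lemma IsRnImmOnData.congr {n q : ℕ} {A : Set (Fin n → ℝ)} {f g : (Fin n → ℝ) → (Fin q → ℝ)}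
    {f' g' : (Fin n → ℝ) → ((Fin n → ℝ) →L[ℝ] (Fin q → ℝ))} (h : IsRnImmOnData n q A f f')
    (hfg : EqOn f g A) (hfg' : EqOn f' g' A) : IsRnImmOnData n q A g g' := by
  obtain ⟨U, l, h1, h2, h3, h4, h5, h6⟩ := h
  exact ⟨U, l, h1, h2, h3, h4, fun x hx => (h5 x hx).trans (hfg hx),
    fun x hx => (h6 x hx).trans (hfg' hx)⟩

lemma IsRnImmOnData.injective {n q : ℕ} {A : Set (Fin n → ℝ)} {f : (Fin n → ℝ) → (Fin q → ℝ)}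
    {f' : (Fin n → ℝ) → ((Fin n → ℝ) →L[ℝ] (Fin q → ℝ))} (h : IsRnImmOnData n q A f f')
    {x : Fin n → ℝ} (hx : x ∈ A) : Injective (f' x) := by
  obtain ⟨U, l, -, hAU, -, hinj, -, h6⟩ := h
  rw [← h6 x hx]
  exact hinj x (hAU hx)

/-- A regular homotopy rel `B` induces a homotopy rel `B` of the frame maps. -/
lemma RnImmHomotopicRel.homotopicRel {n q : ℕ} {A B : Set (Fin n → ℝ)} {F G : RnImmOn n q A}
    (h : RnImmHomotopicRel F G B) {K₁ K₂ : C(↥A, StiefelL n q)}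
    (hK₁ : ∀ x : ↥A, (K₁ x).val = F.f' ↑x) (hK₂ : ∀ x : ↥A, (K₂ x).val = G.f' ↑x) :
    ContinuousMap.HomotopicRel K₁ K₂ {x : ↥A | (↑x : Fin n → ℝ) ∈ B} := by
  obtain ⟨H, H', -, hH', himm, h0, h1, hB⟩ := h
  refine ⟨⟨⟨⟨fun z => ⟨H' (z.2, z.1), (himm z.1 z.1.2).injective z.2.2⟩, ?_⟩, ?_, ?_⟩, ?_⟩⟩
  · refine Continuous.subtype_mk (hH'.comp_continuous (by fun_prop) fun z => ?_) _
    exact ⟨z.2.2, z.1.2⟩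
  · intro x
    exact Subtype.ext ((h0 x x.2).2.trans (hK₁ x).symm)
  · intro x
    exact Subtype.ext ((h1 x x.2).2.trans (hK₂ x).symm)
  · intro t x hx
    exact Subtype.ext ((hB t t.2 x hx).2.trans (hK₁ x).symm)

/-- A homotopy of frame maps over the hemisphere rel the equator is induced by a regular
homotopy. -/
lemma rnImmHomotopicRel_of_homotopicRel {n q : ℕ} [NeZero n] (hnq : n < q)
    {F G : RnImmOn n q (upperHemi n)} (htang : TangentOn F G (equatorSet n))
    {K₁ K₂ : C(↥(upperHemi n), StiefelL n q)}
    (hK₁ : ∀ x : ↥(upperHemi n), (K₁ x).val = F.f' ↑x)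
    (hK₂ : ∀ x : ↥(upperHemi n), (K₂ x).val = G.f' ↑x)
    (h : ContinuousMap.HomotopicRel K₁ K₂
        {x : ↥(upperHemi n) | (↑x : Fin n → ℝ) ∈ equatorSet n}) :
    RnImmHomotopicRel F G (equatorSet n) := by
  classical
  obtain ⟨Φ⟩ := h
  obtain ⟨U₁, l₁, hU₁, hAU₁, hl₁, hf₁, hf₁'⟩ := F.exists_extension
  obtain ⟨U₂, l₂, hU₂, hAU₂, hl₂, hf₂, hf₂'⟩ := G.exists_extension
  let D := upperHemi n
  let X : Set ((Fin n → ℝ) × ℝ) := D ×ˢ Icc (0 : ℝ) 1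
  let B : Set ((Fin n → ℝ) × ℝ) := equatorSet n ×ˢ Icc (0 : ℝ) 1 ∪ D ×ˢ {0, 1}
  have hX : IsCompact X := (isCompact_upperHemi n).prod isCompact_Icc
  have hBc : IsClosed B := (((isCompact_equatorSet n).prod isCompact_Icc).union
    ((isCompact_upperHemi n).prod (Set.toFinite _).isCompact)).isClosed
  have hBX : B ⊆ X := by
    refine union_subset (prod_mono_left (equatorSet_subset_upperHemi n)) (prod_mono_right ?_)
    rintro t (rfl | rfl) <;> simp
  let A : (Fin n → ℝ) × ℝ → (Fin n → ℝ) →L[ℝ] (Fin q → ℝ) := fun p =>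
    (1 - p.2) • fderiv ℝ l₁ p.1 + p.2 • fderiv ℝ l₂ p.1
  have hfst : ContinuousOn (Prod.fst : (Fin n → ℝ) × ℝ → _) X := continuousOn_fst
  have hfd₁ : ContinuousOn (fun p : (Fin n → ℝ) × ℝ => fderiv ℝ l₁ p.1) X :=
    (hl₁.continuousOn_fderiv_of_isOpen hU₁ (by simp)).comp hfst fun p hp => hAU₁ hp.1
  have hfd₂ : ContinuousOn (fun p : (Fin n → ℝ) × ℝ => fderiv ℝ l₂ p.1) X :=
    (hl₂.continuousOn_fderiv_of_isOpen hU₂ (by simp)).comp hfst fun p hp => hAU₂ hp.1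
  have hA : ContinuousOn A X :=
    ((continuousOn_const.sub continuousOn_snd).smul hfd₁).add (continuousOn_snd.smul hfd₂)
  let K : (Fin n → ℝ) × ℝ → (Fin n → ℝ) →L[ℝ] (Fin q → ℝ) := fun p =>
    if hp : p ∈ X then (Φ (⟨p.2, hp.2⟩, ⟨p.1, hp.1⟩)).val else 0
  have hKeq : ∀ p (hp : p ∈ X), K p = (Φ (⟨p.2, hp.2⟩, ⟨p.1, hp.1⟩)).val :=
    fun p hp => dif_pos hp
  have hK : ContinuousOn K X := by
    rw [continuousOn_iff_continuous_domRestrict]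
    have hr : X.domRestrict K = fun p : ↥X =>
        (Φ (⟨p.1.2, p.2.2⟩, ⟨p.1.1, p.2.1⟩)).val := funext fun p => hKeq p.1 p.2
    rw [hr]
    have hval : Continuous fun L : StiefelL n q => L.val := continuous_subtype_val
    refine hval.comp (Φ.continuous.comp ?_)
    exact ((continuous_snd.comp continuous_subtype_val).subtype_mk _).prodMk
      ((continuous_fst.comp continuous_subtype_val).subtype_mk _)
  have hKinj : ∀ p ∈ X, Injective (K p) := fun p hp => by
    rw [hKeq p hp]
    exact (Φ _).2
  have hKA : EqOn K A B := by
    intro p hp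
    rw [hKeq p (hBX hp)]
    rcases hp with ⟨hx, ht⟩ | ⟨hx, ht⟩
    · have hxD := equatorSet_subset_upperHemi n hx
      rw [Φ.eq_fst _ (by exact hx), hK₁]
      simp only [A]
      rw [hf₁' hxD, hf₂' hxD, htang.2 hx]
      module
    · obtain ⟨x, t⟩ := p
      simp only [mem_insert_iff, mem_singleton_iff] at ht
      rcases ht with rfl | rfl
      · have h0 := Φ.apply_zero ⟨x, hx⟩
        refine (congrArg Subtype.val h0).trans ((hK₁ _).trans ?_)
        simp only [A]
        rw [hf₁' hx]
        module
      · have h0 := Φ.apply_one ⟨x, hx⟩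
        refine (congrArg Subtype.val h0).trans ((hK₂ _).trans ?_)
        simp only [A]
        rw [hf₂' hx]
        module
  obtain ⟨g, hg, hgB, hgX⟩ := exists_injective_add_spaceFDeriv_of_eqOn
    (Γ := fun z => (hemiContract n z.1.1 z.2, z.2 * z.1.2)) (p₀ := (Pi.single 0 1, 0))
    (by simpa using hnq) hX hBc hBX
    (((continuous_hemiContract n).comp
      ((continuous_fst.comp continuous_fst).prodMk continuous_snd)).prodMk
      (continuous_snd.mul (continuous_snd.comp continuous_fst))).continuousOn
    (fun z hz => ⟨hemiContract_mem hz.1.1 hz.2,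
      mul_nonneg hz.2.1 hz.1.2.1, mul_le_one₀ hz.2.2 hz.1.2.1 hz.1.2.2⟩)
    (fun p _ => by simp [hemiContract_zero])
    (fun p hp => by simp [hemiContract_one hp.1]) hA hK hKinj hKA
  have hgB0 : ∀ p ∈ B, g p = 0 := fun p hp => (hgB p hp).self_of_nhds
  have hgB' : ∀ p ∈ B, spaceFDeriv g p = 0 := fun p hp => by
    rw [spaceFDeriv, (hgB p hp).fderiv_eq, fderiv_zero]
    exact ContinuousLinearMap.zero_comp _
  let H : (Fin n → ℝ) × ℝ → (Fin q → ℝ) := fun p =>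
    (1 - p.2) • l₁ p.1 + p.2 • l₂ p.1 + g p
  have hHB : ∀ x t, (x, t) ∈ B → H (x, t) = (1 - t) • l₁ x + t • l₂ x ∧
      A (x, t) + spaceFDeriv g (x, t) = A (x, t) := fun x t hp => by
    constructor
    · simp only [H, hgB0 _ hp, add_zero]
    · rw [hgB' _ hp, add_zero]
  refine ⟨H, fun p => A p + spaceFDeriv g p, ?_, hA.add (continuous_spaceFDeriv hg).continuousOn,
    ?_, ?_, ?_, ?_⟩
  · refine (((continuousOn_const.sub continuousOn_snd).smul ?_).add
      (continuousOn_snd.smul ?_)).add hg.continuous.continuousOn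
    · exact hl₁.continuousOn.comp hfst fun p hp => hAU₁ hp.1
    · exact hl₂.continuousOn.comp hfst fun p hp => hAU₂ hp.1
  · intro t ht
    have hsl : ContDiff ℝ (⊤ : ℕ∞) fun x : Fin n → ℝ => g (x, t) :=
      hg.comp (contDiff_id.prodMk contDiff_const)
    have hd : EqOn (fderiv ℝ fun x => H (x, t)) (fun x => A (x, t) + spaceFDeriv g (x, t)) D := by
      intro x hx
      have h1 := ((hl₁.contDiffAt (hU₁.mem_nhds (hAU₁ hx))).differentiableAt
        (by simp)).hasFDerivAt
      have h2 := ((hl₂.contDiffAt (hU₂.mem_nhds (hAU₂ hx))).differentiableAt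
        (by simp)).hasFDerivAt
      have h3 : HasFDerivAt (fun y => g (y, t)) (spaceFDeriv g (x, t)) x :=
        (hg.differentiable (by simp) (x, t)).hasFDerivAt.comp x (hasFDerivAt_prodMk_left x t)
      exact (((h1.const_smul (1 - t)).add (h2.const_smul t)).add h3).fderiv
    refine (isRnImmOnData_of_contDiffOn (l := fun x => H (x, t)) (hU₁.inter hU₂)
      (subset_inter hAU₁ hAU₂) ?_ ?_).congr (eqOn_refl _ _) hd
    · exact (((hl₁.mono inter_subset_left).const_smul (1 - t)).add
        ((hl₂.mono inter_subset_right).const_smul t)).add hsl.contDiffOn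
    · intro x hx
      rw [hd hx]
      exact hgX (x, t) ⟨hx, ht⟩
  · intro x hx
    obtain ⟨e1, e2⟩ := hHB x 0 (Or.inr ⟨hx, by simp⟩)
    beta_reduce
    rw [e1, e2]
    simp [A, hf₁ hx, hf₁' hx]
  · intro x hx
    obtain ⟨e1, e2⟩ := hHB x 1 (Or.inr ⟨hx, by simp⟩)
    beta_reduce
    rw [e1, e2]
    simp [A, hf₂ hx, hf₂' hx]
  · intro t ht x hx
    have hxD := equatorSet_subset_upperHemi n hx
    obtain ⟨e1, e2⟩ := hHB x t (Or.inl ⟨hx, ht⟩)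
    beta_reduce
    rw [e1, e2]
    simp only [A]
    rw [hf₁ hxD, hf₂ hxD, hf₁' hxD, hf₂' hxD, htang.1 hx, htang.2 hx]
    constructor <;> module

/-- two `ℝⁿ`-immersions `(f, f')`, `(g, g')` of a co-oriented
`(n-1)`-simplex (the upper hemisphere of `S^{n-1}`) into `ℝ^{2n-1}`, tangent on the
boundary, are `ℝⁿ`-regularly homotopic rel boundary if and only if the obstruction
`o(f', g')` vanishes.  The vanishing of `o(f', g') = α(Ω(f', g'))` (with `α` an
isomorphism) is expressed by its defining characterisation: the frame maps
`x ↦ f'{e_i(x)}` and `x ↦ g'{e_i(x)}` into the Stiefel manifold `V_{2n-1,n}` are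
homotopic rel the boundary. -/
theorem regular_homotopy_rel_iff_obstruction_vanishes
    (n : ℕ) [NeZero n] (hn : 3 ≤ n)
    (F G : RnImmOn n (2 * n - 1) (upperHemi n))
    (htang : TangentOn F G (equatorSet n))
    (K₁ K₂ : C(↥(upperHemi n), StiefelL n (2 * n - 1)))
    (hK₁ : ∀ x : ↥(upperHemi n), (K₁ x).val = F.f' ↑x)
    (hK₂ : ∀ x : ↥(upperHemi n), (K₂ x).val = G.f' ↑x) :
    RnImmHomotopicRel F G (equatorSet n) ↔
      ContinuousMap.HomotopicRel K₁ K₂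
        {x : ↥(upperHemi n) | (↑x : Fin n → ℝ) ∈ equatorSet n} := by
  exact ⟨fun h => h.homotopicRel hK₁ hK₂,
    rnImmHomotopicRel_of_homotopicRel (by omega) htang hK₁ hK₂⟩
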